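/- Let n : ℕ and z : Fin n → Fin n → ℂ. Then the following are equivalent: (1) z is antisymmetric (z j i = −z i j for all i, j) and satisfies the three-term Plücker relations z i j * z k l + z j k * z i l = z i k * z j l for all i, j, k, l : Fin n; (2) there exists a matrix A : Matrix (Fin n) (Fin 2) ℂ such that z i j = A i 0 * A j 1 − A i 1 * A j 0 for all i, j. (The image of the Plücker embedding of G_{n,2} in ℂP^{N−1}, N = (n choose 2), is exactly the intersection of the quadratic hypersurfaces z_{ij}z_{kl} + z_{jk}z_{il} = z_{ik}z_{jl}, 1 ≤ i < j < k < l ≤ n.) -/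

import Mathlib

/-- An antisymmetric array `z : Fin n → Fin n → ℂ` satisfies the three-term Plücker relations
iff it is decomposable, i.e. iff it is the array of `2 × 2` minors of some `n × 2` complex
matrix.  (The image of the Plücker embedding of `G_{n,2}` is exactly the intersection of the
quadrics `z_{ij} z_{kl} + z_{jk} z_{il} = z_{ik} z_{jl}`.) -/
theorem plucker_relations_iff_decomposable (n : ℕ) (z : Fin n → Fin n → ℂ) :
    ((∀ i j, z j i = -z i j) ∧
      ∀ i j k l, z i j * z k l + z j k * z i l = z i k * z j l) ↔
    ∃ A : Matrix (Fin n) (Fin 2) ℂ, ∀ i j, z i j = A i 0 * A j 1 - A i 1 * A j 0 := by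
  constructor
  · rintro ⟨ha, hp⟩
    by_cases h : ∃ p q, z p q ≠ 0
    · obtain ⟨p, q, hpq⟩ := h
      refine ⟨Matrix.of fun i => ![z i q / z p q, z p i], fun i j => ?_⟩
      have h1 := hp p q i j
      rw [ha i q, ha j q] at h1
      simp only [Matrix.of_apply, Matrix.cons_val_zero, Matrix.cons_val_one]
      field_simp
      linear_combination h1
    · push Not at h
      exact ⟨0, fun i j => by simp [h i j]⟩
  · rintro ⟨A, hA⟩
    refine ⟨fun i j => ?_, fun i j k l => ?_⟩
    · rw [hA, hA]; ring
    · simp only [hA]; ring
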